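/- Let k be any field, let S = k[x, y₁, y₂, t], and let I = (t², y₂t, xy₁, xy₂, y₁², y₁y₂, y₂² − xt). Then the Hilbert function h(m) = dim_k (S/I)_m satisfies h(0) = 1, h(1) = 4, h(2) = 3, and h(m) = 1 for all m ≥ 3; in particular it is independent of the characteristic of k. -/

import Mathlib

open MvPolynomial

/-- The Hilbert function of `S/I`: the `k`-dimension of the degree-`m`
homogeneous component of `S/I`. -/
noncomputable def hilbFn (k : Type*) [Field k] (n : ℕ)
    (I : Ideal (MvPolynomial (Fin n) k)) (m : ℕ) : ℕ :=
  Module.finrank k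
    ((MvPolynomial.homogeneousSubmodule (Fin n) k m).map
      (Ideal.Quotient.mkₐ k I).toLinearMap)

theorem hilbFn_eq_of_dual {k : Type*} [Field k] {n : ℕ} {I : Ideal (MvPolynomial (Fin n) k)}
    {m r : ℕ} (v : Fin r → MvPolynomial (Fin n) k) (hv : ∀ j, (v j).IsHomogeneous m)
    (hspan : (homogeneousSubmodule (Fin n) k m).map (Ideal.Quotient.mkₐ k I).toLinearMap ≤
      Submodule.span k (Set.range fun j => Ideal.Quotient.mk I (v j)))
    (L : Fin r → MvPolynomial (Fin n) k →ₗ[k] k) (hL : ∀ i, ∀ p ∈ I, L i p = 0)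
    (hLv : ∀ i j, L i (v j) = if i = j then 1 else 0) : hilbFn k n I m = r := by
  have hli : LinearIndependent k fun j => Ideal.Quotient.mk I (v j) := by
    rw [Fintype.linearIndependent_iff]
    intro c hc i
    have hmem : ∑ j, c j • v j ∈ I := by
      rw [← Ideal.Quotient.eq_zero_iff_mem, ← hc, map_sum]
      exact Finset.sum_congr rfl fun j _ => map_smul (Ideal.Quotient.mkₐ k I) (c j) (v j)
    simpa [hLv] using hL i _ hmem
  have heq : (homogeneousSubmodule (Fin n) k m).map (Ideal.Quotient.mkₐ k I).toLinearMap =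
      Submodule.span k (Set.range fun j => Ideal.Quotient.mk I (v j)) := by
    refine le_antisymm hspan (Submodule.span_le.2 ?_)
    rintro _ ⟨j, rfl⟩
    exact ⟨v j, hv j, rfl⟩
  rw [hilbFn, heq, finrank_span_eq_card hli, Fintype.card_fin]

theorem map_homogeneousSubmodule_zero_le {k A σ : Type*} [Field k] [CommRing A] [Algebra k A]
    (f : MvPolynomial σ k →ₐ[k] A) :
    (homogeneousSubmodule σ k 0).map f.toLinearMap ≤ Submodule.span k {1} := by
  rintro _ ⟨p, hp, rfl⟩
  rw [SetLike.mem_coe, mem_homogeneousSubmodule, ← totalDegree_zero_iff_isHomogeneous,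
    totalDegree_eq_zero_iff_eq_C] at hp
  rw [hp, Submodule.mem_span_singleton]
  exact ⟨coeff 0 p, by simp [Algebra.smul_def, ← algebraMap_eq]⟩

theorem map_homogeneousSubmodule_succ_le {k A σ : Type*} [Field k] [CommRing A] [Algebra k A]
    (f : MvPolynomial σ k →ₐ[k] A) {m : ℕ} {s : Set A} {W : Submodule k A}
    (hs : (homogeneousSubmodule σ k m).map f.toLinearMap ≤ Submodule.span k s)
    (hW : ∀ i, ∀ a ∈ s, f (X i) * a ∈ W) :
    (homogeneousSubmodule σ k (m + 1)).map f.toLinearMap ≤ W := by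
  rintro _ ⟨p, hp, rfl⟩
  rw [p.as_sum, map_sum]
  refine Submodule.sum_mem _ fun d hd => ?_
  have hdeg : d.degree = m + 1 := by
    rw [Finsupp.degree_eq_weight_one]
    exact hp (mem_support_iff.1 hd)
  obtain ⟨i, hi⟩ : ∃ i, d i ≠ 0 := by
    by_contra! h
    have : d = 0 := Finsupp.ext h
    simp [this] at hdeg
  have hsplit : d = Finsupp.single i 1 + (d - Finsupp.single i 1) :=
    (add_tsub_cancel_of_le (Finsupp.single_le_iff.2 (Nat.one_le_iff_ne_zero.2 hi))).symm
  have hdeg' : (d - Finsupp.single i 1).degree = m := by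
    have := congrArg Finsupp.degree hsplit
    rw [map_add, Finsupp.degree_single] at this
    omega
  have hmem : f (monomial (d - Finsupp.single i 1) (coeff d p)) ∈ Submodule.span k s :=
    hs ⟨_, isHomogeneous_monomial _ hdeg', rfl⟩
  have hmul : Submodule.span k s ≤ W.comap (LinearMap.mulLeft k (f (X i))) :=
    Submodule.span_le.2 (hW i)
  have hmon : monomial d (coeff d p) =
      X i * monomial (d - Finsupp.single i 1) (coeff d p) := by
    rw [X, monomial_mul, one_mul, ← hsplit]
  rw [AlgHom.toLinearMap_apply, hmon, map_mul]
  exact hmul hmem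

theorem coeff_mul_of_isHomogeneous_of_degree_le {k σ : Type*} [Field k] {g : MvPolynomial σ k}
    {n : ℕ} (hg : g.IsHomogeneous n) (a : MvPolynomial σ k) {d : σ →₀ ℕ} (hd : d.degree ≤ n) :
    coeff d (a * g) = coeff 0 a * coeff d g := by
  classical
  rw [coeff_mul, Finset.sum_eq_single (0, d)]
  · rintro ⟨e, e'⟩ he hne
    rw [Finset.HasAntidiagonal.mem_antidiagonal] at he
    rw [hg.coeff_eq_zero, mul_zero]
    intro h'
    have := congrArg Finsupp.degree he
    rw [map_add] at this
    dsimp only at this h'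
    have he0 : e = 0 := by
      rw [← Finsupp.degree_eq_zero_iff]
      omega
    subst he0
    simp_all
  · simp

/-- A sum of coefficients in degrees at most `n` vanishes on an ideal generated by forms of
degree `n` as soon as it vanishes on the generators. -/
theorem sum_coeff_eq_zero_of_mem_span {k σ : Type*} [Field k]
    {G : Set (MvPolynomial σ k)} {n : ℕ} (hG : ∀ g ∈ G, g.IsHomogeneous n)
    {D : Finset (σ →₀ ℕ)} (hD : ∀ d ∈ D, d.degree ≤ n)
    (hDG : ∀ g ∈ G, ∑ d ∈ D, coeff d g = 0)
    {p : MvPolynomial σ k} (hp : p ∈ Ideal.span G) : ∑ d ∈ D, coeff d p = 0 := by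
  suffices h : ∀ a, ∑ d ∈ D, coeff d (a * p) = 0 by simpa using h 1
  induction hp using Submodule.span_induction with
  | mem g hg =>
    intro a
    rw [Finset.sum_congr rfl fun d hd =>
      coeff_mul_of_isHomogeneous_of_degree_le (hG g hg) a (hD d hd), ← Finset.mul_sum,
      hDG g hg, mul_zero]
  | zero => simp
  | add p q _ _ hp hq => simp [mul_add, Finset.sum_add_distrib, hp, hq]
  | smul b p _ ih =>
    intro a
    rw [smul_eq_mul, ← mul_assoc]
    exact ih _

theorem coeff_X_mul_X {k σ : Type*} [Field k] [DecidableEq σ] (i j a b : σ) :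
    coeff (Finsupp.single i 1 + Finsupp.single j 1) (X a * X b : MvPolynomial σ k) =
      if a = i ∧ b = j ∨ a = j ∧ b = i then 1 else 0 := by
  rw [X, X, monomial_mul, one_mul, coeff_monomial]
  simp only [Finsupp.single_add_single_eq_single_add_single one_ne_zero one_ne_zero]
  congr 1
  simp

section Spanning

variable {k A : Type*} [Field k] [CommRing A] [Algebra k A] {f : MvPolynomial (Fin 4) k →ₐ[k] A}
  {x y₁ y₂ t : A}

theorem map_homogeneousSubmodule_one_le (f : MvPolynomial (Fin 4) k →ₐ[k] A) :
    (homogeneousSubmodule (Fin 4) k 1).map f.toLinearMap ≤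
      Submodule.span k (Set.range fun j => f (X j)) := by
  refine map_homogeneousSubmodule_succ_le f (map_homogeneousSubmodule_zero_le f) fun i a ha => ?_
  rw [Set.mem_singleton_iff.1 ha, mul_one]
  exact Submodule.subset_span ⟨i, rfl⟩

theorem map_homogeneousSubmodule_two_le (hf : ∀ i, f (X i) = ![x, y₁, y₂, t] i)
    (htt : t ^ 2 = 0) (hyt : y₂ * t = 0) (hxy₁ : x * y₁ = 0) (hxy₂ : x * y₂ = 0)
    (hy₁y₁ : y₁ ^ 2 = 0) (hy₁y₂ : y₁ * y₂ = 0) (hy₂y₂ : y₂ ^ 2 = x * t) :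
    (homogeneousSubmodule (Fin 4) k 2).map f.toLinearMap ≤
      Submodule.span k {x ^ 2, x * t, y₁ * t} := by
  refine map_homogeneousSubmodule_succ_le f (map_homogeneousSubmodule_one_le f) ?_
  have hxx : x ^ 2 ∈ Submodule.span k {x ^ 2, x * t, y₁ * t} := Submodule.subset_span (by simp)
  have hxt : x * t ∈ Submodule.span k {x ^ 2, x * t, y₁ * t} := Submodule.subset_span (by simp)
  have hy₁t : y₁ * t ∈ Submodule.span k {x ^ 2, x * t, y₁ * t} := Submodule.subset_span (by simp)
  simp only [Set.forall_mem_range, hf]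
  intro i j
  fin_cases i <;> fin_cases j <;>
    simp [← pow_two, mul_comm y₁ x, mul_comm y₂ x, mul_comm y₂ y₁, mul_comm t, hxx, hxt, hy₁t,
      htt, hyt, hxy₁, hxy₂, hy₁y₁, hy₁y₂, hy₂y₂]

theorem map_homogeneousSubmodule_add_three_le (hf : ∀ i, f (X i) = ![x, y₁, y₂, t] i)
    (htt : t ^ 2 = 0) (hyt : y₂ * t = 0) (hxy₁ : x * y₁ = 0) (hxy₂ : x * y₂ = 0)
    (hy₁y₁ : y₁ ^ 2 = 0) (hy₁y₂ : y₁ * y₂ = 0) (hy₂y₂ : y₂ ^ 2 = x * t) (m : ℕ) :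
    (homogeneousSubmodule (Fin 4) k (m + 3)).map f.toLinearMap ≤
      Submodule.span k {x ^ (m + 3)} := by
  have hxxt : x ^ 2 * t = 0 := by linear_combination y₂ * hxy₂ - x * hy₂y₂
  have hzero : ∀ n, ∀ a, a = 0 → a ∈ Submodule.span k {x ^ n} := by
    rintro n _ rfl
    exact Submodule.zero_mem _
  have hpow : ∀ n, x * x ^ n ∈ Submodule.span k {x ^ (n + 1)} := fun n => by
    rw [← pow_succ']
    exact Submodule.mem_span_singleton_self _
  induction m with
  | zero =>
    refine map_homogeneousSubmodule_succ_le f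
      (map_homogeneousSubmodule_two_le hf htt hyt hxy₁ hxy₂ hy₁y₁ hy₁y₂ hy₂y₂) ?_
    simp only [hf, Set.mem_insert_iff, Set.mem_singleton_iff, forall_eq_or_imp, forall_eq]
    intro i
    fin_cases i <;> simp only [Fin.zero_eta, Fin.mk_one, Fin.reduceFinMk, Matrix.cons_val]
    · exact ⟨hpow 2, hzero _ _ (by linear_combination hxxt),
        hzero _ _ (by linear_combination t * hxy₁)⟩
    · exact ⟨hzero _ _ (by linear_combination x * hxy₁),
        hzero _ _ (by linear_combination t * hxy₁), hzero _ _ (by linear_combination t * hy₁y₁)⟩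
    · exact ⟨hzero _ _ (by linear_combination x * hxy₂),
        hzero _ _ (by linear_combination t * hxy₂), hzero _ _ (by linear_combination t * hy₁y₂)⟩
    · exact ⟨hzero _ _ (by linear_combination hxxt),
        hzero _ _ (by linear_combination x * htt), hzero _ _ (by linear_combination y₁ * htt)⟩
  | succ m ih =>
    refine map_homogeneousSubmodule_succ_le f ih ?_
    simp only [hf, Set.mem_singleton_iff, forall_eq]
    intro i
    fin_cases i <;> simp only [Fin.zero_eta, Fin.mk_one, Fin.reduceFinMk, Matrix.cons_val]
    · exact hpow (m + 3)
    · exact hzero _ _ (by linear_combination x ^ (m + 2) * hxy₁)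
    · exact hzero _ _ (by linear_combination x ^ (m + 2) * hxy₂)
    · exact hzero _ _ (by linear_combination x ^ (m + 1) * hxxt)

end Spanning

theorem stmt18 (k : Type*) [Field k] :
    letI x : MvPolynomial (Fin 4) k := X 0
    letI y₁ : MvPolynomial (Fin 4) k := X 1
    letI y₂ : MvPolynomial (Fin 4) k := X 2
    letI t : MvPolynomial (Fin 4) k := X 3
    letI I : Ideal (MvPolynomial (Fin 4) k) :=
      Ideal.span {t ^ 2, y₂ * t, x * y₁, x * y₂,
        y₁ ^ 2, y₁ * y₂, y₂ ^ 2 - x * t}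
    hilbFn k 4 I 0 = 1 ∧ hilbFn k 4 I 1 = 4 ∧ hilbFn k 4 I 2 = 3 ∧
      ∀ m, 3 ≤ m → hilbFn k 4 I m = 1 := by
  set G : Set (MvPolynomial (Fin 4) k) := {X 3 ^ 2, X 2 * X 3, X 0 * X 1, X 0 * X 2, X 1 ^ 2,
    X 1 * X 2, X 2 ^ 2 - X 0 * X 3} with hGdef
  set I := Ideal.span G
  set q := Ideal.Quotient.mkₐ k I
  have hgen : ∀ g ∈ G, q g = 0 := fun g hg =>
    Ideal.Quotient.eq_zero_iff_mem.2 (Ideal.subset_span hg)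
  have hG : ∀ g ∈ G, g.IsHomogeneous 2 := by
    have h := isHomogeneous_X k (σ := Fin 4)
    simp only [hGdef, Set.mem_insert_iff, Set.mem_singleton_iff, forall_eq_or_imp, forall_eq]
    exact ⟨(h 3).pow 2, (h 2).mul (h 3), (h 0).mul (h 1), (h 0).mul (h 2), (h 1).pow 2,
      (h 1).mul (h 2), ((h 2).pow 2).sub ((h 0).mul (h 3))⟩
  simp only [hGdef, Set.mem_insert_iff, Set.mem_singleton_iff, forall_eq_or_imp, forall_eq,
    map_mul, map_pow, map_sub, sub_eq_zero] at hgen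
  obtain ⟨htt, hyt, hxy₁, hxy₂, hy₁y₁, hy₁y₂, hy₂y₂⟩ := hgen
  have hq : ∀ i, q (X i) = ![q (X 0), q (X 1), q (X 2), q (X 3)] i := by
    intro i
    fin_cases i <;> rfl
  have hpow : ∀ m, (homogeneousSubmodule (Fin 4) k m).map q.toLinearMap ≤
      Submodule.span k {q (X 0) ^ m} → hilbFn k 4 I m = 1 := by
    intro m hm
    refine hilbFn_eq_of_dual (fun _ : Fin 1 => X 0 ^ m) (fun _ => isHomogeneous_X_pow 0 m)
      (by rw [Set.range_const, map_pow]; exact hm)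
      (fun _ => (aeval ![1, 0, 0, 0] : MvPolynomial (Fin 4) k →ₐ[k] k).toLinearMap) ?_ ?_
    · intro _ p hp
      have hle : I ≤ RingHom.ker (aeval ![1, 0, 0, 0] : MvPolynomial (Fin 4) k →ₐ[k] k) := by
        refine Ideal.span_le.2 ?_
        simp [G, Set.insert_subset_iff]
      exact hle hp
    · intro i j
      simp [Subsingleton.elim i j]
  refine ⟨hpow 0 (by simpa using map_homogeneousSubmodule_zero_le q), ?_, ?_, fun m hm => ?_⟩
  · refine hilbFn_eq_of_dual X (isHomogeneous_X k) (map_homogeneousSubmodule_one_le q)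
      (fun i => lcoeff k (Finsupp.single i 1)) ?_ ?_
    · intro i p hp
      have hzero : ∀ g ∈ G, coeff (Finsupp.single i 1) g = 0 := fun g hg =>
        (hG g hg).coeff_eq_zero (by simp)
      simpa using sum_coeff_eq_zero_of_mem_span hG (D := {Finsupp.single i 1}) (by simp)
        (by simpa using hzero) hp
    · intro i j
      simp [coeff_X, Finsupp.single_left_inj, eq_comm]
  · let e (i j : Fin 4) : Fin 4 →₀ ℕ := Finsupp.single i 1 + Finsupp.single j 1
    let D : Fin 3 → Finset (Fin 4 →₀ ℕ) := ![{e 0 0}, {e 0 3, e 2 2}, {e 1 3}]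
    have he : e 0 3 ≠ e 2 2 := fun h => by simpa [e] using DFunLike.congr_fun h 0
    refine hilbFn_eq_of_dual ![X 0 ^ 2, X 0 * X 3, X 1 * X 3] ?_ ?_
      (fun i => ∑ d ∈ D i, lcoeff k d) ?_ ?_
    · have h := isHomogeneous_X k (σ := Fin 4)
      intro i
      fin_cases i
      exacts [(h 0).pow 2, (h 0).mul (h 3), (h 1).mul (h 3)]
    · refine (map_homogeneousSubmodule_two_le hq htt hyt hxy₁ hxy₂ hy₁y₁ hy₁y₂ hy₂y₂).trans
        (Submodule.span_mono ?_)
      rintro _ (rfl | rfl | rfl)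
      exacts [⟨0, rfl⟩, ⟨1, rfl⟩, ⟨2, rfl⟩]
    · intro i p hp
      have hD : ∀ d ∈ D i, d.degree ≤ 2 := by
        fin_cases i <;> simp [D, e]
      have hDG : ∀ g ∈ G, ∑ d ∈ D i, coeff d g = 0 := by
        fin_cases i <;>
          simp [D, hGdef, Finset.sum_pair he, e, pow_two, coeff_X_mul_X]
      simpa using sum_coeff_eq_zero_of_mem_span hG hD hDG hp
    · intro i j
      fin_cases i <;> fin_cases j <;>
        simp [D, Finset.sum_pair he, e, pow_two, coeff_X_mul_X]
  · obtain ⟨m, rfl⟩ := Nat.exists_eq_add_of_le' hm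
    exact hpow _ (map_homogeneousSubmodule_add_three_le hq htt hyt hxy₁ hxy₂ hy₁y₁ hy₁y₂ hy₂y₂ m)
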